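/- (Lemma 6.6, subsolution restriction to a slice.) Let u : ℝ^m × ℝ^d → ℝ be upper semicontinuous and locally bounded from above. Suppose that for every smooth ψ : ℝ^m × ℝ^d → ℝ and every point (ζ̄, ϑ̄) at which u − ψ attains a local maximum, one has ∇_ϑψ(ζ̄, ϑ̄)ᵀ A(ζ̄) ∇_ϑψ(ζ̄, ϑ̄) ≤ n(ζ̄, ϑ̄). Then for every fixed ζ₀ ∈ ℝ^m the slice ϑ ↦ u(ζ₀, ϑ) is a viscosity subsolution of the frozen Eikonal equation: for every smooth φ : ℝ^d → ℝ and every ϑ₀ at which u(ζ₀, ·) − φ attains a local maximum, ∇φ(ϑ₀)ᵀ A(ζ₀) ∇φ(ϑ₀) ≤ n(ζ₀, ϑ₀). -/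

import Mathlib

open Matrix

/-- Gradient of a function on `ℝ^d`: the vector of partial derivatives. -/
noncomputable def grad {d : ℕ} (φ : (Fin d → ℝ) → ℝ) (x : Fin d → ℝ) : Fin d → ℝ :=
  fun i => fderiv ℝ φ x (Pi.single i 1)

/-- Partial gradient in the second block of variables `ϑ` of a function on `ℝ^m × ℝ^d`. -/
noncomputable def gradSnd {m d : ℕ} (ψ : (Fin m → ℝ) × (Fin d → ℝ) → ℝ)
    (p : (Fin m → ℝ) × (Fin d → ℝ)) : Fin d → ℝ :=
  fun i => fderiv ℝ (fun y => ψ (p.1, y)) p.2 (Pi.single i 1)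

/-- The squared Euclidean distance to `a`, as a function on `ℝ^k`. -/
def sqDist {k : ℕ} (a x : Fin k → ℝ) : ℝ := ∑ i, (x i - a i) ^ 2

lemma sqDist_self {k : ℕ} (a : Fin k → ℝ) : sqDist a a = 0 := by simp [sqDist]

lemma sqDist_nonneg {k : ℕ} (a x : Fin k → ℝ) : 0 ≤ sqDist a x :=
  Finset.sum_nonneg fun _ _ => sq_nonneg _

lemma sqDist_pos {k : ℕ} {a x : Fin k → ℝ} (h : x ≠ a) : 0 < sqDist a x := by
  obtain ⟨i, hi⟩ := Function.ne_iff.1 h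
  exact Finset.sum_pos' (fun _ _ => sq_nonneg _)
    ⟨i, Finset.mem_univ i, sq_pos_of_ne_zero (sub_ne_zero.2 hi)⟩

lemma contDiff_sqDist {k : ℕ} (a : Fin k → ℝ) : ContDiff ℝ (⊤ : ℕ∞) (sqDist a) := by
  unfold sqDist
  fun_prop

lemma fderiv_sqDist_self {k : ℕ} (a : Fin k → ℝ) : fderiv ℝ (sqDist a) a = 0 :=
  IsLocalMin.fderiv_eq_zero
    (Filter.Eventually.of_forall fun x => (sqDist_self a).trans_le (sqDist_nonneg a x))

lemma grad_add_sqDist {k : ℕ} {φ : (Fin k → ℝ) → ℝ} {a : Fin k → ℝ}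
    (hφ : DifferentiableAt ℝ φ a) : grad (fun x => φ x + sqDist a x) a = grad φ a := by
  have h := fderiv_fun_add hφ ((contDiff_sqDist a).differentiable (by simp) a)
  funext i
  simp [grad, h, fderiv_sqDist_self]

lemma continuous_grad {k : ℕ} {φ : (Fin k → ℝ) → ℝ} (hφ : ContDiff ℝ (⊤ : ℕ∞) φ) :
    Continuous (grad φ) :=
  continuous_pi fun _ => (hφ.continuous_fderiv (by simp)).clm_apply continuous_const

lemma gradSnd_add_fst {m d : ℕ} (φ : (Fin d → ℝ) → ℝ) (g : (Fin m → ℝ) → ℝ)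
    (p : (Fin m → ℝ) × (Fin d → ℝ)) :
    gradSnd (fun q => φ q.2 + g q.1) p = grad φ p.2 := by
  funext i
  simp [gradSnd, grad, fderiv_add_const]

/-- An upper semicontinuous function that is smaller on a sphere than at its center has a local
maximum in the open ball. -/
lemma UpperSemicontinuous.exists_isLocalMax_mem_ball {X : Type*} [PseudoMetricSpace X]
    [ProperSpace X] {f : X → ℝ} (hf : UpperSemicontinuous f) {x : X} {r : ℝ} (hr : 0 < r)
    (h : ∀ y ∈ Metric.sphere x r, f y < f x) : ∃ y ∈ Metric.ball x r, IsLocalMax f y := by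
  obtain ⟨y, hy, hmax⟩ := (hf.upperSemicontinuousOn _).exists_isMaxOn
    ⟨x, Metric.mem_closedBall_self hr.le⟩ (isCompact_closedBall x r)
  have hyb : y ∈ Metric.ball x r := by
    rcases (Metric.mem_closedBall.1 hy).lt_or_eq with hlt | heq
    · exact hlt
    · exact absurd (h y heq) (hmax (Metric.mem_closedBall_self hr.le)).not_gt
  exact ⟨y, hyb, hmax.isLocalMax (Metric.closedBall_mem_nhds_of_mem hyb)⟩

/-- If the slice `u (a, ·) - φ` is strictly maximal at `b` on a small closed ball, then a large
penalization of the first variable produces a local maximum near `(a, b)`. -/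
lemma exists_isLocalMax_penalized {m d : ℕ} {u : (Fin m → ℝ) × (Fin d → ℝ) → ℝ}
    (hu : UpperSemicontinuous u) {φ : (Fin d → ℝ) → ℝ} (hφ : Continuous φ)
    {a : Fin m → ℝ} {b : Fin d → ℝ} {r : ℝ} (hr : 0 < r)
    (hmax : ∀ y ∈ Metric.closedBall b r, y ≠ b → u (a, y) - φ y < u (a, b) - φ b) :
    ∃ k : ℕ, ∃ p ∈ Metric.ball (a, b) r,
      IsLocalMax (fun q => u q - (φ q.2 + k * sqDist a q.1)) p := by
  have husc (k : ℕ) : UpperSemicontinuous fun q => u q - (φ q.2 + k * sqDist a q.1) := by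
    have hc : Continuous fun q : (Fin m → ℝ) × (Fin d → ℝ) =>
        -(φ q.2 + k * sqDist a q.1) := by
      have := (contDiff_sqDist a).continuous
      fun_prop
    simpa only [sub_eq_add_neg] using hu.add hc.upperSemicontinuous
  obtain ⟨k, hk⟩ := (isCompact_sphere (a, b) r).elim_directed_cover
    (fun k : ℕ => {q | u q - (φ q.2 + k * sqDist a q.1) < u (a, b) - φ b})
    (fun k => (husc k).isOpen_preimage _)
    (by
      rintro ⟨x, y⟩ hq
      rw [Set.mem_iUnion]
      by_cases hx : x = a
      · subst hx
        have hd : dist y b = r := by simpa [Prod.dist_eq, dist_eq_norm, hr.le] using hq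
        have hne : y ≠ b := by
          rintro rfl
          simp [hr.ne] at hd
        exact ⟨0, by simpa using hmax y hd.le hne⟩
      · obtain ⟨k, hk⟩ := exists_nat_gt ((u (x, y) - φ y - (u (a, b) - φ b)) / sqDist a x)
        rw [div_lt_iff₀ (sqDist_pos hx)] at hk
        exact ⟨k, by simp only [Set.mem_ofPred_eq]; linarith⟩)
    (directed_of_isDirected_le fun i j hij q hq => by
      have hij' : (i : ℝ) * sqDist a q.1 ≤ j * sqDist a q.1 :=
        mul_le_mul_of_nonneg_right (Nat.cast_le.2 hij) (sqDist_nonneg _ _)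
      simp only [Set.mem_ofPred_eq] at hq ⊢
      linarith)
  refine ⟨k, (husc k).exists_isLocalMax_mem_ball hr fun q hq => ?_⟩
  simpa [sqDist_self] using hk hq

/-- Lemma 6.6 (subsolution restriction to a slice): if the upper semicontinuous, locally
bounded from above function `u(ζ,ϑ)` is a viscosity subsolution of
`(∇_ϑ u)ᵀ A(ζ) ∇_ϑ u ≤ n(ζ,ϑ)`, then for every fixed `ζ₀` the slice `ϑ ↦ u(ζ₀,ϑ)` is a
viscosity subsolution of the frozen Eikonal equation. -/
theorem eikonal_subsolution_slice {m d : ℕ} (hm : 1 ≤ m) (hd : 1 ≤ d)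
    (n : (Fin m → ℝ) × (Fin d → ℝ) → ℝ) (hn : Continuous n)
    (A : (Fin m → ℝ) → Matrix (Fin d) (Fin d) ℝ) (hA : Continuous A)
    (hAsymm : ∀ ζ, (A ζ).IsSymm)
    (u : (Fin m → ℝ) × (Fin d → ℝ) → ℝ) (husc : UpperSemicontinuous u)
    (hlocbdd : ∀ p : (Fin m → ℝ) × (Fin d → ℝ),
      ∃ s ∈ nhds p, BddAbove (u '' s))
    (hsub : ∀ ψ : (Fin m → ℝ) × (Fin d → ℝ) → ℝ, ContDiff ℝ (⊤ : ℕ∞) ψ →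
      ∀ p : (Fin m → ℝ) × (Fin d → ℝ), IsLocalMax (fun q => u q - ψ q) p →
        gradSnd ψ p ⬝ᵥ (A p.1).mulVec (gradSnd ψ p) ≤ n p) :
    ∀ ζ₀ : Fin m → ℝ, ∀ φ : (Fin d → ℝ) → ℝ, ContDiff ℝ (⊤ : ℕ∞) φ →
      ∀ ϑ₀ : Fin d → ℝ, IsLocalMax (fun ϑ => u (ζ₀, ϑ) - φ ϑ) ϑ₀ →
        grad φ ϑ₀ ⬝ᵥ (A ζ₀).mulVec (grad φ ϑ₀) ≤ n (ζ₀, ϑ₀) := by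
  intro ζ₀ φ hφ ϑ₀ hmax
  obtain ⟨r, hr, hball⟩ := Metric.eventually_nhds_iff.1 hmax
  let Φ : (Fin d → ℝ) → ℝ := fun y => φ y + sqDist ϑ₀ y
  have hΦ : ContDiff ℝ (⊤ : ℕ∞) Φ := hφ.add (contDiff_sqDist ϑ₀)
  have hclosed : IsClosed {p : (Fin m → ℝ) × (Fin d → ℝ) |
      grad Φ p.2 ⬝ᵥ (A p.1).mulVec (grad Φ p.2) ≤ n p} := by
    have hg : Continuous fun p : (Fin m → ℝ) × (Fin d → ℝ) => grad Φ p.2 :=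
      (continuous_grad hΦ).comp continuous_snd
    exact isClosed_le (hg.dotProduct ((hA.comp continuous_fst).matrix_mulVec hg)) hn
  have hmem : (ζ₀, ϑ₀) ∈ closure {p : (Fin m → ℝ) × (Fin d → ℝ) |
      grad Φ p.2 ⬝ᵥ (A p.1).mulVec (grad Φ p.2) ≤ n p} := by
    refine Metric.mem_closure_iff.2 fun ε hε => ?_
    have hδ : 0 < min ε (r / 2) := lt_min hε (half_pos hr)
    obtain ⟨k, p, hp, hloc⟩ := exists_isLocalMax_penalized husc hΦ.continuous
      (a := ζ₀) (b := ϑ₀) hδ fun y hy hne => by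
        have hyr : dist y ϑ₀ < r :=
          ((Metric.mem_closedBall.1 hy).trans (min_le_right _ _)).trans_lt (half_lt_self hr)
        have h₁ := hball hyr
        have h₂ := sqDist_pos hne
        simp only [Φ, sqDist_self]
        linarith
    have hψ : ContDiff ℝ (⊤ : ℕ∞) fun q : (Fin m → ℝ) × (Fin d → ℝ) =>
        Φ q.2 + k * sqDist ζ₀ q.1 :=
      (hΦ.comp contDiff_snd).add (contDiff_const.mul ((contDiff_sqDist ζ₀).comp contDiff_fst))
    have hle := hsub _ hψ p hloc
    rw [gradSnd_add_fst Φ fun x => k * sqDist ζ₀ x] at hle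
    exact ⟨p, hle, (dist_comm _ _).trans_lt ((Metric.mem_ball.1 hp).trans_le (min_le_left _ _))⟩
  have h := hclosed.closure_subset hmem
  rwa [Set.mem_ofPred_eq, grad_add_sqDist (hφ.differentiable (by simp) ϑ₀)] at h
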